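/- If f ∈ Homeo₀(T²) has a rotation set that is stable in Homeo₀(T²), then for any lift f̃ of f the rotation set ρ(f̃) is a convex polygon with rational vertices; that is, ρ(f̃) is the convex hull of a finite subset of ℚ². -/

import Mathlib

noncomputable section

open Metric Set Filter Topology MeasureTheory Pointwise

/-- The plane `ℝ²` with the Euclidean metric. -/
abbrev R2 : Type := EuclideanSpace ℝ (Fin 2)

/-- The integer lattice `ℤ² ⊂ ℝ²`. -/
def intLattice : AddSubgroup R2 where
  carrier := {v : R2 | ∀ i, ∃ n : ℤ, v i = (n : ℝ)}
  add_mem' := by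
    intro a b ha hb i
    obtain ⟨m, hm⟩ := ha i
    obtain ⟨n, hn⟩ := hb i
    exact ⟨m + n, by push_cast; rw [← hm, ← hn]; rfl⟩
  zero_mem' := fun i => ⟨0, by simp⟩
  neg_mem' := by
    intro a ha i
    obtain ⟨m, hm⟩ := ha i
    exact ⟨-m, by push_cast; rw [← hm]; rfl⟩

/-- The torus `T² = ℝ²/ℤ²`, with the quotient (Euclidean) metric. -/
abbrev T2 : Type := R2 ⧸ intLattice

/-- The covering projection `π : ℝ² → T²`. -/
def pr : R2 → T2 := QuotientAddGroup.mk

instance : MeasurableSpace T2 := borel T2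
instance : BorelSpace T2 := ⟨rfl⟩

/-- A fundamental domain `[0,1)²` for the lattice action. -/
def fundDomain : Set R2 := {x : R2 | ∀ i, x i ∈ Set.Ico (0 : ℝ) 1}

/-- Lebesgue (Haar) probability measure on the torus `T²`. -/
def lebT2 : Measure T2 := Measure.map pr (volume.restrict fundDomain)

/-- `F : ℝ² → ℝ²` is a lift of `f : T² → T²` if `π ∘ F = f ∘ π` and
`F (x + w) = F x + w` for every lattice vector `w ∈ ℤ²`. -/
structure IsLift (f : T2 ≃ₜ T2) (F : R2 ≃ₜ R2) : Prop where
  proj : ∀ x : R2, pr (F x) = f (pr x)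
  equivariant : ∀ x : R2, ∀ w ∈ intLattice, F (x + w) = F x + w

/-- `Homeo₀(T²)`: homeomorphisms of the torus isotopic to the identity,
characterized as those admitting a lift commuting with integer translations. -/
def Homeo0 : Set (T2 ≃ₜ T2) := {f | ∃ F : R2 ≃ₜ R2, IsLift f F}

/-- `Homeo_{0,λ}(T²)`: elements of `Homeo₀(T²)` preserving Lebesgue measure. -/
def Homeo0Leb : Set (T2 ≃ₜ T2) :=
  {f | f ∈ Homeo0 ∧ MeasurePreserving f lebT2 lebT2}

/-- The uniform `C⁰` distance `d_{C⁰}(f,g) = sup_x d(f(x), g(x))` on torus maps. -/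
def dC0 (f g : T2 ≃ₜ T2) : ℝ := ⨆ x : T2, dist (f x) (g x)

/-- The uniform distance `sup_{x ∈ ℝ²} ‖F(x) − G(x)‖` between maps of the plane. -/
def supDist (F G : R2 → R2) : ℝ := ⨆ x : R2, dist (F x) (G x)

/-- The rotation set `ρ(F̃)` of a lift: all limits `(F̃^{n_k}(z_k) − z_k)/n_k`. -/
def rotSet (F : R2 ≃ₜ R2) : Set R2 :=
  {v | ∃ (z : ℕ → R2) (n : ℕ → ℕ), Tendsto n atTop atTop ∧
    Tendsto (fun k => (n k : ℝ)⁻¹ • ((⇑F)^[n k] (z k) - z k)) atTop (𝓝 v)}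

/-- The rotation set of `f`, with fixed lift `F`, is `δ`-upper-stable in `H`. -/
def UpperStable (H : Set (T2 ≃ₜ T2)) (F : R2 ≃ₜ R2) (δ : ℝ) : Prop :=
  ∀ g ∈ H, ∀ G : R2 ≃ₜ R2, IsLift g G → supDist (⇑F) (⇑G) < δ →
    rotSet G ⊆ rotSet F

/-- The rotation set of `f`, with fixed lift `F`, is `δ`-stable in `H`. -/
def StableRS (H : Set (T2 ≃ₜ T2)) (F : R2 ≃ₜ R2) (δ : ℝ) : Prop :=
  ∀ g ∈ H, ∀ G : R2 ≃ₜ R2, IsLift g G → supDist (⇑F) (⇑G) < δ →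
    rotSet G = rotSet F

/-- `f` has a stable rotation set in `H`. -/
def HasStableRotSet (H : Set (T2 ≃ₜ T2)) (f : T2 ≃ₜ T2) : Prop :=
  ∃ F : R2 ≃ₜ R2, IsLift f F ∧ ∃ δ > 0, StableRS H F δ

/-- `S` is open in `H` for the uniform `C⁰` topology. -/
def OpenIn (H S : Set (T2 ≃ₜ T2)) : Prop :=
  ∀ f ∈ S ∩ H, ∃ δ > 0, ∀ g ∈ H, dC0 f g < δ → g ∈ S

/-- `S` is dense in `H` for the uniform `C⁰` topology. -/
def DenseIn (H S : Set (T2 ≃ₜ T2)) : Prop :=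
  ∀ f ∈ H, ∀ ε > 0, ∃ g ∈ S ∩ H, dC0 f g < ε

/-- `(x_i)_{0 ≤ i ≤ n}` is a finite `ε`-pseudo-orbit of `F`. -/
def IsPseudoOrbitUpTo (F : R2 → R2) (ε : ℝ) (x : ℕ → R2) (n : ℕ) : Prop :=
  ∀ i < n, dist (F (x i)) (x (i + 1)) < ε

/-- `(x_i)_{i ∈ ℕ}` is an infinite `ε`-pseudo-orbit of `F`. -/
def IsPseudoOrbit (F : R2 → R2) (ε : ℝ) (x : ℕ → R2) : Prop :=
  ∀ i : ℕ, dist (F (x i)) (x (i + 1)) < ε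

/-- The `ε`-pseudo-rotation set `ρ_ε(F̃)`. -/
def pseudoRotSet (F : R2 → R2) (ε : ℝ) : Set R2 :=
  {v | ∃ (n : ℕ → ℕ) (x : ℕ → ℕ → R2), Tendsto n atTop atTop ∧
    (∀ k, IsPseudoOrbitUpTo F ε (x k) (n k)) ∧
    Tendsto (fun k => (n k : ℝ)⁻¹ • (x k (n k) - x k 0)) atTop (𝓝 v)}

/-- The oscillation `osc(f) = sup_{x,y} ‖(F(x) − x) − (F(y) − y)‖` of a lift. -/
def osc (F : R2 → R2) : ℝ := ⨆ p : R2 × R2, ‖(F p.1 - p.1) - (F p.2 - p.2)‖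

/-- `f` has the shadowing property. -/
def Shadowing (f : T2 ≃ₜ T2) : Prop :=
  ∀ ε > 0, ∃ δ > 0, ∀ x : ℕ → T2, (∀ i, dist (f (x i)) (x (i + 1)) < δ) →
    ∃ z : T2, ∀ i, dist ((⇑f)^[i] z) (x i) < ε

/-- `v ∈ ℚ² ⊂ ℝ²`. -/
def IsRationalPoint (v : R2) : Prop := ∀ i, ∃ q : ℚ, v i = (q : ℝ)


open Complex in
lemma exp_lift_unique (f g : ℝ → ℂ) (hf : Continuous f) (hg : Continuous g)
    (h0 : f 0 = g 0) (h : ∀ s, exp (f s) = exp (g s)) (s : ℝ) : f s = g s := by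
  have := isCoveringMapOn_exp.existsUnique_continuousMap_lifts (A := ℝ)
    (⟨fun s => exp (f s), by fun_prop⟩ : C(ℝ, ℂ)) (a₀ := 0) (e₀ := f 0) rfl
    (fun a => by simp)
  have e := this.unique (y₁ := ⟨f, hf⟩) (y₂ := ⟨g, hg⟩) ⟨rfl, rfl⟩
    ⟨h0.symm, by ext s; simp [h]⟩
  exact congrArg (fun F : C(ℝ, ℂ) => F s) e

open Complex in
lemma winding_key (γ : ℝ → ℂ) (hγ : Continuous γ) (v : ℂ)
    (hne : ∀ s t, γ s - γ t - v ≠ 0)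
    (hr : ∀ s, 0 < ((γ s - (γ 1 - v)) / (γ s - (γ 0 + v))).re) :
    0 < ((γ 1 - (γ 0 + v)) / (γ 0 - (γ 0 + v))).re := by
  obtain ⟨L, ⟨-, hL⟩, -⟩ := isCoveringMapOn_exp.existsUnique_continuousMap_lifts (A := ℝ × ℝ)
    (⟨fun p => γ p.1 - γ p.2 - v, by fun_prop⟩ : C(ℝ × ℝ, ℂ)) (a₀ := (0, 0))
    (e₀ := log (γ 0 - γ 0 - v)) (by simpa using exp_log (hne 0 0))
    (fun a => by simpa using hne a.1 a.2)
  have hL' : ∀ s t, exp (L (s, t)) = γ s - γ t - v := fun s t => congrFun hL (s, t)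
  have hLc : Continuous L := L.continuous
  have hq : ∀ s, γ s - (γ 0 + v) ≠ 0 := fun s => by
    have := hne s 0; rwa [← sub_sub]
  have hq' : ∀ s, γ s - (γ 1 - v) ≠ 0 := fun s => by
    have := hne 1 s
    intro h; apply this; linear_combination -h
  set r : ℝ → ℂ := fun s => (γ s - (γ 1 - v)) / (γ s - (γ 0 + v)) with hrdef
  have hrne : ∀ s, r s ≠ 0 := fun s => div_ne_zero (hq' s) (hq s)
  have hrc : Continuous r := by
    apply Continuous.div _ _ hq <;> fun_prop
  have hlogc : Continuous (fun s => log (r s)) :=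
    hrc.clog (fun s => Or.inl (hr s))
  have hdiag : L (1, 1) = L (0, 0) := by
    have := exp_lift_unique (fun s => L (s, s)) (fun _ => L (0, 0)) (by fun_prop) (by fun_prop) rfl
      (fun s => by rw [hL', hL']; ring) 1
    exact this
  have hAB := exp_lift_unique (fun s => L (1, s) - L (1, 0))
    (fun s => L (s, 0) - L (0, 0) + (log (r s) - log (r 0))) (by fun_prop) (by fun_prop) (by simp)
    (fun s => by
      simp only [exp_add, exp_sub, hL', exp_log (hrne _)]
      simp only [hrdef]
      have h1 := hq s; have h2 := hq 0; have h3 := hq' s; have h4 := hq' 0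
      have h5 := hne 1 0
      have h6 := hne 0 0
      have e1 : γ 1 - γ s - v = -(γ s - (γ 1 - v)) := by ring
      have e2 : γ 1 - γ 0 - v = -(γ 0 - (γ 1 - v)) := by ring
      have e3 : γ s - γ 0 - v = γ s - (γ 0 + v) := by ring
      have e4 : γ 0 - γ 0 - v = γ 0 - (γ 0 + v) := by ring
      rw [e1, e2, e3, e4]
      field_simp) 1
  simp only [hdiag] at hAB
  have h2 : 2 * (L (1, 0) - L (0, 0)) = log (r 0) - log (r 1) := by linear_combination -hAB
  have him : 2 * (L (1, 0) - L (0, 0)).im = arg (r 0) - arg (r 1) := by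
    have := congrArg Complex.im h2
    simpa [log_im] using this
  have hexp : (γ 1 - (γ 0 + v)) / (γ 0 - (γ 0 + v)) = exp (L (1, 0) - L (0, 0)) := by
    rw [exp_sub, hL', hL']; ring
  rw [hexp, exp_re]
  have a0 := abs_lt.1 (abs_arg_lt_pi_div_two_iff.2 (Or.inl (hr 0)))
  have a1 := abs_lt.1 (abs_arg_lt_pi_div_two_iff.2 (Or.inl (hr 1)))
  apply mul_pos (Real.exp_pos _)
  apply Real.cos_pos_of_mem_Ioo
  constructor <;> linarith [a0.1, a0.2, a1.1, a1.2]

/-- commutes with integer translations -/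
def Eqv (F : R2 → R2) : Prop := ∀ x, ∀ w ∈ intLattice, F (x + w) = F x + w

lemma inner_R2 (x y : R2) : inner ℝ x y = x 0 * y 0 + x 1 * y 1 := by
  simp [PiLp.inner_apply, Fin.sum_univ_two, mul_comm]

lemma norm_le_R2 (x : R2) : ‖x‖ ≤ |x 0| + |x 1| := by
  rw [EuclideanSpace.norm_eq, Fin.sum_univ_two]
  apply Real.sqrt_le_iff.2
  refine ⟨by positivity, ?_⟩
  simp only [Real.norm_eq_abs]
  nlinarith [abs_nonneg (x 0), abs_nonneg (x 1)]

def toC (x : R2) : ℂ := ⟨x 0, x 1⟩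

lemma winding_R2 (γ : ℝ → R2) (hγ : Continuous γ) (v : R2)
    (hne : ∀ s t, γ s ≠ γ t + v)
    (hr : ∀ s, 0 < inner ℝ (γ s - (γ 1 - v)) (γ s - (γ 0 + v))) :
    0 < inner ℝ (γ 1 - (γ 0 + v)) (γ 0 - (γ 0 + v)) := by
  have hc : Continuous (fun s => toC (γ s)) := by
    have : (fun s => toC (γ s)) = fun s => ((γ s 0 : ℝ) : ℂ) + ((γ s 1 : ℝ) : ℂ) * Complex.I := by
      ext s; apply Complex.ext <;> simp [toC]
    rw [this]; fun_prop
  have key : ∀ x y : R2, (0 < (toC x / toC y).re ↔ 0 < inner ℝ x y) := by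
    intro x y
    rw [inner_R2, Complex.div_re]
    simp only [toC]
    by_cases hy : Complex.normSq ⟨y 0, y 1⟩ = 0
    · rw [hy]
      rw [Complex.normSq_eq_zero] at hy
      have h0 := congrArg Complex.re hy
      have h1 := congrArg Complex.im hy
      simp only [Complex.zero_re, Complex.zero_im] at h0 h1
      simp [h0, h1]
    · have : 0 < Complex.normSq ⟨y 0, y 1⟩ := lt_of_le_of_ne (Complex.normSq_nonneg _) (Ne.symm hy)
      rw [← add_div]
      constructor
      · intro h
        by_contra h'
        exact absurd h (not_lt.2 (div_nonpos_of_nonpos_of_nonneg (not_lt.1 h') this.le))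
      · intro h; positivity
  have sub : ∀ x y : R2, toC (x - y) = toC x - toC y := by
    intro x y; apply Complex.ext <;> simp [toC]
  have add : ∀ x y : R2, toC (x + y) = toC x + toC y := by
    intro x y; apply Complex.ext <;> simp [toC]
  have inj : ∀ x y : R2, toC x = toC y → x = y := by
    intro x y h
    have h0 := congrArg Complex.re h
    have h1 := congrArg Complex.im h
    ext i; fin_cases i
    · exact h0
    · exact h1
  have := winding_key (fun s => toC (γ s)) hc (toC v)
    (fun s t h => hne s t (inj _ _ (by rw [add]; linear_combination h)))
    (fun s => by
      rw [← sub, ← add, ← sub, ← sub, key]; exact hr s)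
  rw [← add, ← sub, ← sub, key] at this
  exact this

def roundVec (x : R2) : R2 := !₂[(round (x 0) : ℝ), (round (x 1) : ℝ)]

def floorVec (x : R2) : R2 := !₂[(⌊x 0⌋ : ℝ), (⌊x 1⌋ : ℝ)]

lemma roundVec_mem (x : R2) : roundVec x ∈ intLattice := by
  intro i; fin_cases i
  · exact ⟨round (x 0), by simp [roundVec]⟩
  · exact ⟨round (x 1), by simp [roundVec]⟩

lemma floorVec_mem (x : R2) : floorVec x ∈ intLattice := by
  intro i; fin_cases i
  · exact ⟨⌊x 0⌋, by simp [floorVec]⟩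
  · exact ⟨⌊x 1⌋, by simp [floorVec]⟩

lemma norm_sub_roundVec (x : R2) : ‖x - roundVec x‖ ≤ 1 := by
  refine (norm_le_R2 _).trans ?_
  have h0 := abs_sub_round (x 0)
  have h1 := abs_sub_round (x 1)
  simp only [roundVec, PiLp.sub_apply]
  simp only [Matrix.cons_val_zero, Matrix.cons_val_one]
  linarith

lemma sub_floorVec_mem (x : R2) (i : Fin 2) : (x - floorVec x) i ∈ Set.Ico (0 : ℝ) 1 := by
  fin_cases i <;> simp [floorVec] <;> exact Int.fract_lt_one _

lemma quasi_mid_aux (G : R2 → R2) (hc : Continuous G) (hi : Function.Injective G) (hG : Eqv G)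
    (a b : R2) (ha : ∀ i, a i ∈ Set.Ico (0 : ℝ) 1) (hb : ∀ i, b i ∈ Set.Ico (0 : ℝ) 1) :
    ∃ z, ‖G z - z - (1 / 2 : ℝ) • ((G a - a) + (G b - b))‖ < 10 := by
  by_contra hcon
  push Not at hcon
  set m : R2 := (1 / 2 : ℝ) • ((G a - a) + (G b - b)) with hm
  let cl : ℝ → ℝ := fun s => max 0 (min 1 s)
  have hcl0 : ∀ s, 0 ≤ cl s := fun s => le_max_left _ _
  have hcl1 : ∀ s, cl s ≤ 1 := fun s => max_le zero_le_one (min_le_left _ _)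
  have hclc : Continuous cl := by fun_prop
  let σ : ℝ → R2 := fun s => a + cl s • (b - a)
  have hσ : ∀ s i, σ s i ∈ Set.Ico (0 : ℝ) 1 := by
    intro s i
    have h1 := ha i; have h2 := hb i; have h3 := hcl0 s; have h4 := hcl1 s
    have e : σ s i = a i + cl s * (b i - a i) := by simp [σ]
    rw [e]
    constructor
    · nlinarith [h1.1, h2.1]
    · rcases eq_or_lt_of_le h4 with h | h
      · rw [h]; linarith [h2.2]
      · nlinarith [h1.2, h2.2]
  have hσ0 : σ 0 = a := by simp [σ, cl]
  have hσ1 : σ 1 = b := by simp [σ, cl]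
  let γ : ℝ → R2 := fun s => G (σ s)
  have hγ : Continuous γ := by
    apply hc.comp; fun_prop
  have hγ0 : γ 0 = G a := by simp [γ, hσ0]
  have hγ1 : γ 1 = G b := by simp [γ, hσ1]
  set d : R2 := (1 / 2 : ℝ) • (G b - G a) with hd
  set v := roundVec d with hv
  have hvd : ‖d - v‖ ≤ 1 := norm_sub_roundVec d
  have hvm : v ∈ intLattice := roundVec_mem d
  have small : ∀ x y : R2, (∀ i, x i ∈ Set.Ico (0 : ℝ) 1) → (∀ i, y i ∈ Set.Ico (0 : ℝ) 1) →
      ‖x - y‖ ≤ 2 := by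
    intro x y hx hy
    refine (norm_le_R2 _).trans ?_
    have := hx 0; have := hx 1; have := hy 0; have := hy 1
    simp only [Set.mem_Ico] at *
    have : |(x - y) 0| ≤ 1 := by simp only [PiLp.sub_apply]; rw [abs_le]; constructor <;> linarith
    have : |(x - y) 1| ≤ 1 := by simp only [PiLp.sub_apply]; rw [abs_le]; constructor <;> linarith
    linarith
  have hdn : 9 ≤ ‖d‖ := by
    have h1 := hcon a
    have h2 := small a b ha hb
    have e : d = -(G a - a - m) + (1/2 : ℝ) • (b - a) := by
      rw [hm, hd]; module
    have h3 : ‖(1/2 : ℝ) • (b - a)‖ ≤ 1 := by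
      rw [norm_smul, norm_sub_rev]; norm_num; linarith
    have h4 : ‖G a - a - m‖ ≤ ‖d‖ + ‖(1/2 : ℝ) • (b - a)‖ := by
      have : G a - a - m = (1/2 : ℝ) • (b - a) - d := by rw [e]; module
      rw [this]; linarith [norm_sub_le ((1/2 : ℝ) • (b - a)) d]
    linarith
  have hv0 : v ≠ 0 := by
    intro h; rw [h, sub_zero] at hvd; linarith
  have hne : ∀ s t, γ s ≠ γ t + v := by
    intro s t h
    have h1 : G (σ s) = G (σ t + v) := by rw [hG _ _ hvm]; exact h
    have h2 := hi h1
    apply hv0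
    ext i
    obtain ⟨k, hk⟩ := hvm i
    have h3 : σ s i = σ t i + v i := by rw [h2]; simp
    have h4 := hσ s i; have h5 := hσ t i
    simp only [Set.mem_Ico] at h4 h5
    have h6 : (k : ℝ) < 1 := by linarith
    have h7 : (-1 : ℝ) < k := by linarith
    have h6' : k < 1 := by exact_mod_cast h6
    have h7' : -1 < k := by exact_mod_cast h7
    have : k = 0 := by omega
    rw [hk, this]; simp
  have hfar : ∀ s, 5 ≤ ‖γ s - (G a + v)‖ := by
    intro s
    have h1 := hcon (σ s)
    have e : G (σ s) - σ s - m = (γ s - (G a + v)) - (d - v) + (1/2 : ℝ) • (a - σ s)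
        + (1/2 : ℝ) • (b - σ s) := by
      rw [hm, hd]; simp only [γ]; module
    have h2 := small a (σ s) ha (hσ s)
    have h3 := small b (σ s) hb (hσ s)
    have h4 : ‖(1/2 : ℝ) • (a - σ s)‖ ≤ 1 := by
      rw [norm_smul]; norm_num; linarith
    have h5 : ‖(1/2 : ℝ) • (b - σ s)‖ ≤ 1 := by
      rw [norm_smul]; norm_num; linarith
    rw [e] at h1
    have h6 := norm_add_le ((γ s - (G a + v)) - (d - v) + (1/2 : ℝ) • (a - σ s)) ((1/2 : ℝ) • (b - σ s))
    have h7 := norm_add_le ((γ s - (G a + v)) - (d - v)) ((1/2 : ℝ) • (a - σ s))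
    have h8 := norm_sub_le (γ s - (G a + v)) (d - v)
    linarith
  have hfin := winding_R2 γ hγ v hne (by
    intro s
    rw [hγ0, hγ1]
    have e : γ s - (G b - v) = (γ s - (G a + v)) - (2 : ℝ) • (d - v) := by rw [hd]; module
    rw [e, inner_sub_left, real_inner_self_eq_norm_sq, inner_smul_left]
    have h1 := hfar s
    have h2 := real_inner_le_norm (d - v) (γ s - (G a + v))
    simp only [conj_trivial]
    have h3 : ‖d - v‖ * ‖γ s - (G a + v)‖ ≤ 1 * ‖γ s - (G a + v)‖ := by gcongr
    nlinarith)
  rw [hγ0, hγ1] at hfin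
  have e1 : G b - (G a + v) = d + (d - v) := by rw [hd]; module
  have e2 : G a - (G a + v) = (d - v) - d := by module
  rw [e1, e2] at hfin
  have e3 : inner ℝ (d + (d - v)) ((d - v) - d) = ‖d - v‖ ^ 2 - ‖d‖ ^ 2 := by
    generalize d - v = e
    rw [inner_add_left, inner_sub_right, inner_sub_right, real_inner_self_eq_norm_sq,
      real_inner_self_eq_norm_sq, real_inner_comm d e]
    ring
  rw [e3] at hfin
  nlinarith [norm_nonneg (d - v)]

lemma quasi_mid (G : R2 → R2) (hc : Continuous G) (hi : Function.Injective G) (hG : Eqv G)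
    (a b : R2) : ∃ z, ‖G z - z - (1 / 2 : ℝ) • ((G a - a) + (G b - b))‖ < 10 := by
  have key : ∀ x, G (x - floorVec x) - (x - floorVec x) = G x - x := by
    intro x
    have := hG (x - floorVec x) _ (floorVec_mem x)
    rw [sub_add_cancel] at this
    rw [this]; abel
  have := quasi_mid_aux G hc hi hG _ _ (sub_floorVec_mem a) (sub_floorVec_mem b)
  rwa [key, key] at this

lemma Eqv.iterate {F : R2 → R2} (hF : Eqv F) (n : ℕ) : Eqv (F^[n]) := by
  induction n with
  | zero => intro x w _; rfl
  | succ n ih => 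
    intro x w hw
    rw [Function.iterate_succ_apply', Function.iterate_succ_apply', ih x w hw, hF _ w hw]

lemma exists_disp_bound (F : R2 → R2) (hc : Continuous F) (hF : Eqv F) :
    ∃ B > 0, ∀ z, ‖F z - z‖ ≤ B := by
  have hK : IsCompact (closedBall (0 : R2) 2) := isCompact_closedBall _ _
  obtain ⟨B, hB⟩ := hK.exists_bound_of_continuousOn (f := fun z => F z - z) (by fun_prop)
  refine ⟨max B 1, by positivity, fun z => le_max_of_le_left ?_⟩
  have h1 := hF (z - floorVec z) _ (floorVec_mem z)
  rw [sub_add_cancel] at h1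
  have h2 : F z - z = F (z - floorVec z) - (z - floorVec z) := by rw [h1]; abel
  rw [h2]
  apply hB
  rw [mem_closedBall_zero_iff]
  refine (norm_le_R2 _).trans ?_
  have h3 := sub_floorVec_mem z 0
  have h4 := sub_floorVec_mem z 1
  rw [abs_of_nonneg h3.1, abs_of_nonneg h4.1]
  linarith [h3.2, h4.2]

lemma iterate_bound (F : R2 → R2) (B : ℝ) (hB : ∀ z, ‖F z - z‖ ≤ B) (n : ℕ) (z : R2) :
    ‖F^[n] z - z‖ ≤ n * B := by
  induction n with
  | zero => simp
  | succ n ih =>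
    rw [Function.iterate_succ_apply']
    have : F (F^[n] z) - z = (F (F^[n] z) - F^[n] z) + (F^[n] z - z) := by abel
    rw [this]
    refine (norm_add_le _ _).trans ?_
    push_cast
    linarith [hB (F^[n] z)]

/-- If a linear functional is bounded by `α` on displacements at time `m`, it is on the rotation set. -/
lemma functional_bound (F : R2 ≃ₜ R2) (l : R2 →L[ℝ] ℝ) (α C : ℝ)
    (h : ∀ n : ℕ, ∀ z, l (F^[n] z - z) ≤ α * n + C) : ∀ x ∈ rotSet F, l x ≤ α := by
  rintro x ⟨z, n, hn, hx⟩
  have h1 : Tendsto (fun k => l ((n k : ℝ)⁻¹ • ((⇑F)^[n k] (z k) - z k))) atTop (𝓝 (l x)) :=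
    (l.continuous.tendsto x).comp hx
  have h2 : Tendsto (fun k => α + C * (n k : ℝ)⁻¹) atTop (𝓝 (α + C * 0)) := by
    apply Tendsto.const_add
    apply Tendsto.const_mul
    exact tendsto_inv_atTop_zero.comp (tendsto_natCast_atTop_atTop.comp hn)
  rw [mul_zero, add_zero] at h2
  refine le_of_tendsto_of_tendsto h1 h2 ?_
  filter_upwards [hn.eventually_ge_atTop 1] with k hk
  have hk' : (0 : ℝ) < n k := by exact_mod_cast hk
  rw [map_smul, smul_eq_mul]
  have := h (n k) (z k)
  calc (n k : ℝ)⁻¹ * l (F^[n k] (z k) - z k) ≤ (n k : ℝ)⁻¹ * (α * n k + C) := by gcongr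
    _ = α + C * (n k : ℝ)⁻¹ := by field_simp

lemma functional_one (F : R2 → R2) (hc : Continuous F) (hF : Eqv F) (l : R2 →L[ℝ] ℝ) (α : ℝ)
    (m : ℕ) (hm : 0 < m) (h : ∀ z, l ((m : ℝ)⁻¹ • (F^[m] z - z)) ≤ α) :
    ∃ C, ∀ n : ℕ, ∀ z, l (F^[n] z - z) ≤ α * n + C := by
  obtain ⟨B, hB0, hB⟩ := exists_disp_bound F hc hF
  have hm' : (0 : ℝ) < m := by exact_mod_cast hm
  have h' : ∀ z, l (F^[m] z - z) ≤ α * m := by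
    intro z
    have := h z
    rw [map_smul, smul_eq_mul, inv_mul_le_iff₀ hm'] at this
    linarith
  refine ⟨‖l‖ * (m * B) + |α| * m, fun n => ?_⟩
  induction n using Nat.strong_induction_on with
  | _ n ih =>
    intro z
    by_cases hn : n < m
    · have h1 := iterate_bound F B hB n z
      have h2 := (le_abs_self _).trans (l.le_opNorm (F^[n] z - z))
      have hnm : (n : ℝ) ≤ m := by exact_mod_cast hn.le
      have h3 : ‖l‖ * ‖F^[n] z - z‖ ≤ ‖l‖ * (m * B) := by
        gcongr; exact h1.trans (by gcongr)
      have h4 : -(α * n) ≤ |α| * m := by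
        calc -(α * n) ≤ |α * n| := neg_le_abs _
          _ = |α| * n := by rw [abs_mul, abs_of_nonneg (by positivity : (0:ℝ) ≤ n)]
          _ ≤ |α| * m := by gcongr
      linarith
    · push Not at hn
      obtain ⟨k, rfl⟩ := Nat.exists_eq_add_of_le' hn
      have h1 := ih k (by omega) (F^[m] z)
      have h2 := h' z
      rw [Function.iterate_add_apply]
      have : F^[k] (F^[m] z) - z = (F^[k] (F^[m] z) - F^[m] z) + (F^[m] z - z) := by abel
      rw [this, map_add]
      push_cast
      linarith

def KU (U : Ultrafilter ℕ) (F : R2 → R2) : Set R2 :=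
  {x | ∀ ε > 0, ∀ᶠ n : ℕ in (U : Filter ℕ), ∃ z, ‖(n : ℝ)⁻¹ • (F^[n] z - z) - x‖ < ε}

lemma KU_subset (U : Ultrafilter ℕ) (hU : (U : Filter ℕ) ≤ atTop) (F : R2 ≃ₜ R2) :
    KU U F ⊆ rotSet F := by
  intro x hx
  have : ∀ k : ℕ, ∃ n : ℕ, k ≤ n ∧ ∃ z, ‖(n : ℝ)⁻¹ • (F^[n] z - z) - x‖ < 1 / ((k : ℝ) + 1) := by
    intro k
    have h1 := hx (1 / ((k : ℝ) + 1)) (by positivity)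
    have h2 : ∀ᶠ n : ℕ in (U : Filter ℕ), k ≤ n := hU (eventually_ge_atTop k)
    exact (h2.and h1).exists
  choose n hn z hz using this
  refine ⟨z, n, tendsto_atTop_mono hn tendsto_id, ?_⟩
  rw [tendsto_iff_norm_sub_tendsto_zero]
  exact squeeze_zero (fun _ => norm_nonneg _) (fun k => (hz k).le) tendsto_one_div_add_atTop_nhds_zero_nat

lemma KU_closed (U : Ultrafilter ℕ) (F : R2 → R2) : IsClosed (KU U F) := by
  rw [← closure_subset_iff_isClosed]
  intro x hx ε hε
  obtain ⟨y, hy, hxy⟩ := Metric.mem_closure_iff.1 hx (ε / 2) (by positivity)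
  filter_upwards [hy (ε / 2) (by positivity)] with n hn
  obtain ⟨z, hz⟩ := hn
  refine ⟨z, ?_⟩
  rw [dist_eq_norm, norm_sub_rev] at hxy
  have : (n : ℝ)⁻¹ • (F^[n] z - z) - x = ((n : ℝ)⁻¹ • (F^[n] z - z) - y) + (y - x) := by abel
  rw [this]
  linarith [norm_add_le ((n : ℝ)⁻¹ • (F^[n] z - z) - y) (y - x)]

lemma KU_mid (U : Ultrafilter ℕ) (hU : (U : Filter ℕ) ≤ atTop) (F : R2 ≃ₜ R2) (hF : Eqv F)
    (x y : R2) (hx : x ∈ KU U F) (hy : y ∈ KU U F) : (1 / 2 : ℝ) • (x + y) ∈ KU U F := by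
  intro ε hε
  have h3 : ∀ᶠ n : ℕ in atTop, 10 * (n : ℝ)⁻¹ < ε / 2 := by
    have : Tendsto (fun n : ℕ => 10 * (n : ℝ)⁻¹) atTop (𝓝 (10 * 0)) :=
      tendsto_const_nhds.mul (tendsto_inv_atTop_zero.comp tendsto_natCast_atTop_atTop)
    rw [mul_zero] at this
    exact this.eventually_lt_const (by positivity)
  filter_upwards [hx (ε / 2) (by positivity), hy (ε / 2) (by positivity), hU h3,
    hU (eventually_ge_atTop 1)] with n ⟨a, ha⟩ ⟨b, hb⟩ hn hn1
  have hn0 : (0 : ℝ) < n := by exact_mod_cast hn1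
  obtain ⟨z, hz⟩ := quasi_mid (F^[n]) (F.continuous.iterate n) (F.injective.iterate n)
    (hF.iterate n) a b
  refine ⟨z, ?_⟩
  set P := F^[n] a - a
  set Q := F^[n] b - b
  set S := F^[n] z - z
  have e : (n : ℝ)⁻¹ • S - (1 / 2 : ℝ) • (x + y) = (n : ℝ)⁻¹ • (S - (1 / 2 : ℝ) • (P + Q))
      + ((1 / 2 : ℝ) • ((n : ℝ)⁻¹ • P - x) + (1 / 2 : ℝ) • ((n : ℝ)⁻¹ • Q - y)) := by module
  rw [e]
  have n1 : ‖(n : ℝ)⁻¹ • (S - (1 / 2 : ℝ) • (P + Q))‖ ≤ 10 * (n : ℝ)⁻¹ := by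
    rw [norm_smul, Real.norm_of_nonneg (by positivity), mul_comm]
    gcongr
  have n2 : ‖(1 / 2 : ℝ) • ((n : ℝ)⁻¹ • P - x)‖ ≤ ε / 4 := by
    rw [norm_smul, Real.norm_of_nonneg (by positivity)]; linarith
  have n3 : ‖(1 / 2 : ℝ) • ((n : ℝ)⁻¹ • Q - y)‖ ≤ ε / 4 := by
    rw [norm_smul, Real.norm_of_nonneg (by positivity)]; linarith
  have m1 := norm_add_le ((n : ℝ)⁻¹ • (S - (1 / 2 : ℝ) • (P + Q))) ((1 / 2 : ℝ) • ((n : ℝ)⁻¹ • P - x) + (1 / 2 : ℝ) • ((n : ℝ)⁻¹ • Q - y))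
  have m2 := norm_add_le ((1 / 2 : ℝ) • ((n : ℝ)⁻¹ • P - x)) ((1 / 2 : ℝ) • ((n : ℝ)⁻¹ • Q - y))
  linarith

/-- A closed midpoint-convex set is convex. -/
lemma convex_of_closed_mid (S : Set R2) (hS : IsClosed S)
    (h : ∀ x ∈ S, ∀ y ∈ S, (1 / 2 : ℝ) • (x + y) ∈ S) : Convex ℝ S := by
  rw [convex_iff_segment_subset]
  intro x hx y hy
  rw [segment_eq_image_lineMap]
  rintro _ ⟨t, ht, rfl⟩
  by_contra hcon
  set f : ℝ → R2 := fun t => AffineMap.lineMap x y t with hf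
  have hfc : Continuous f := by
    have : f = fun t => t • (y - x) + x := by ext t; simp [hf, AffineMap.lineMap_apply]
    rw [this]; fun_prop
  have hmid : ∀ a b, f a ∈ S → f b ∈ S → f ((a + b) / 2) ∈ S := by
    intro a b ha hb
    have := h _ ha _ hb
    convert this using 1
    simp only [hf, AffineMap.lineMap_apply, vsub_eq_sub, vadd_eq_add]
    module
  set A := f ⁻¹' S ∩ Set.Icc 0 t with hA
  set B := f ⁻¹' S ∩ Set.Icc t 1 with hB
  have hAc : IsCompact A := (isCompact_Icc).inter_left (hS.preimage hfc)
  have hBc : IsCompact B := (isCompact_Icc).inter_left (hS.preimage hfc)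
  have hAn : A.Nonempty := ⟨0, by simp [hA, hf, hx, ht.1]⟩
  have hBn : B.Nonempty := ⟨1, by simp [hB, hf, hy, ht.2]⟩
  obtain ⟨a, ha⟩ := hAc.exists_isGreatest hAn
  obtain ⟨b, hb⟩ := hBc.exists_isLeast hBn
  have hat : a < t := lt_of_le_of_ne ha.1.2.2 (fun e => hcon (e ▸ ha.1.1))
  have htb : t < b := lt_of_le_of_ne hb.1.2.1 (fun e => hcon (e ▸ hb.1.1))
  have hm := hmid a b ha.1.1 hb.1.1
  have h0 := ha.1.2.1
  have h1 := hb.1.2.2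
  rcases le_total ((a + b) / 2) t with hle | hle
  · have := ha.2 (show (a + b) / 2 ∈ A from ⟨hm, by constructor <;> linarith⟩)
    linarith
  · have := hb.2 (show (a + b) / 2 ∈ B from ⟨hm, by constructor <;> linarith⟩)
    linarith

lemma rotSet_convex (F : R2 ≃ₜ R2) (hF : Eqv F) : Convex ℝ (rotSet F) := by
  set U : Ultrafilter ℕ := Filter.hyperfilter ℕ
  have hU : (U : Filter ℕ) ≤ atTop := by
    rw [← Nat.cofinite_eq_atTop]; exact Filter.hyperfilter_le_cofinite
  have hcl := KU_closed U F
  have hconv := convex_of_closed_mid _ hcl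
    (fun x hx y hy => KU_mid U hU F hF x y hx hy)
  suffices h : rotSet F = KU U F by rw [h]; exact hconv
  refine subset_antisymm ?_ (KU_subset U hU F)
  intro x hx
  by_contra hxK
  obtain ⟨l, α, h1, h2⟩ := geometric_hahn_banach_closed_point hconv hcl hxK
  obtain ⟨B, hB0, hB⟩ := exists_disp_bound F F.continuous hF
  have hex : ∀ᶠ n : ℕ in (U : Filter ℕ), ∀ z, l ((n : ℝ)⁻¹ • (F^[n] z - z)) ≤ α := by
    by_contra hne
    rw [← Ultrafilter.eventually_not] at hne
    push Not at hne
    have : ∃ z : ℕ → R2, ∀ᶠ n : ℕ in (U : Filter ℕ), α < l ((n : ℝ)⁻¹ • (F^[n] (z n) - z n)) := by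
      classical
      refine ⟨fun n => if h : ∃ z, α < l ((n : ℝ)⁻¹ • (F^[n] z - z)) then h.choose else 0, ?_⟩
      filter_upwards [hne] with n hn
      simp only [dif_pos hn]
      exact hn.choose_spec
    obtain ⟨z, hz⟩ := this
    set g : ℕ → R2 := fun n => (n : ℝ)⁻¹ • (F^[n] (z n) - z n) with hg
    have hbd : ∀ n, g n ∈ closedBall (0 : R2) B := by
      intro n
      rw [mem_closedBall_zero_iff, hg]
      simp only
      rw [norm_smul, Real.norm_of_nonneg (by positivity)]
      rcases Nat.eq_zero_or_pos n with h0 | h0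
      · subst h0; simp [hB0.le]
      · have : (0 : ℝ) < n := by exact_mod_cast h0
        rw [inv_mul_le_iff₀ this]
        exact iterate_bound F B hB n (z n)
    obtain ⟨y, -, hy⟩ := (isCompact_closedBall (0 : R2) B).ultrafilter_le_nhds (U.map g)
      (by
        rw [Filter.le_principal_iff, Ultrafilter.mem_coe, Ultrafilter.mem_map]
        exact Filter.univ_mem' hbd)
    have hy' : Tendsto g U (𝓝 y) := hy
    have hyK : y ∈ KU U F := by
      intro ε hε
      have := (Metric.tendsto_nhds.1 hy') ε hε
      filter_upwards [this] with n hn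
      exact ⟨z n, by rwa [dist_eq_norm] at hn⟩
    have h3 := h1 y hyK
    have h4 : Tendsto (fun n => l (g n)) U (𝓝 (l y)) := (l.continuous.tendsto y).comp hy'
    have := ge_of_tendsto h4 (hz.mono fun n hn => hn.le)
    linarith
  have h1U : ∀ᶠ n : ℕ in (U : Filter ℕ), 1 ≤ n := hU (eventually_ge_atTop 1)
  obtain ⟨n, hn, hn0⟩ := (hex.and h1U).exists
  obtain ⟨C, hC⟩ := functional_one F F.continuous hF l α n hn0 hn
  have := functional_bound F l α C hC x hx
  linarith

def tent (s : ℝ) : ℝ := 2 * min (Int.fract s) (1 - Int.fract s)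

lemma tent_nonneg (s : ℝ) : 0 ≤ tent s := by
  have h1 := Int.fract_nonneg s
  have h2 := Int.fract_lt_one s
  have := le_min h1 (sub_nonneg.2 h2.le)
  unfold tent; linarith

lemma tent_le_one (s : ℝ) : tent s ≤ 1 := by
  unfold tent
  rcases le_total (Int.fract s) (1 - Int.fract s) with h | h
  · rw [min_eq_left h]; linarith
  · rw [min_eq_right h]; linarith

lemma tent_same (s t : ℝ) (h : ⌊s⌋ = ⌊t⌋) : |tent s - tent t| ≤ 2 * |s - t| := by
  unfold tent
  have e : Int.fract s - Int.fract t = s - t := by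
    unfold Int.fract; rw [h]; ring
  rw [← mul_sub, abs_mul, abs_of_pos (by norm_num : (0 : ℝ) < 2)]
  refine mul_le_mul_of_nonneg_left ?_ (by norm_num)
  refine (abs_min_sub_min_le_max (Int.fract s) (1 - Int.fract s) (Int.fract t) (1 - Int.fract t)).trans ?_
  rw [e]
  have : 1 - Int.fract s - (1 - Int.fract t) = -(s - t) := by rw [← e]; ring
  rw [this, abs_neg, max_self]

lemma tent_diff (s t : ℝ) (h : ⌊s⌋ ≠ ⌊t⌋) : tent s + tent t ≤ 2 * |s - t| := by
  wlog hlt : ⌊s⌋ < ⌊t⌋ generalizing s t with H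
  · have := H t s h.symm (lt_of_le_of_ne (not_lt.1 hlt) h.symm)
    rw [abs_sub_comm]; linarith
  have h1 : (⌊s⌋ : ℝ) + 1 ≤ ⌊t⌋ := by exact_mod_cast hlt
  have h2 : tent s ≤ 2 * (1 - Int.fract s) := by
    unfold tent; gcongr; exact min_le_right _ _
  have h3 : tent t ≤ 2 * Int.fract t := by
    unfold tent; gcongr; exact min_le_left _ _
  have h4 : Int.fract s = s - ⌊s⌋ := rfl
  have h5 : Int.fract t = t - ⌊t⌋ := rfl
  have := neg_le_abs (s - t)
  linarith

lemma tent_half (k : ℤ) : tent (k + 1 / 2) = 1 := by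
  unfold tent
  rw [Int.fract_intCast_add]
  have : Int.fract (1 / 2 : ℝ) = 1 / 2 := Int.fract_eq_self.2 (by norm_num)
  rw [this]; norm_num

def cellOf (N : ℕ) (x : Fin 2 → ℝ) : Fin 2 → ℤ := fun i => ⌊(N : ℝ) * x i⌋

def bump (N : ℕ) (x : Fin 2 → ℝ) : ℝ := min (tent (N * x 0)) (tent (N * x 1))

lemma bump_nonneg (N : ℕ) (x : Fin 2 → ℝ) : 0 ≤ bump N x := le_min (tent_nonneg _) (tent_nonneg _)

lemma bump_le_one (N : ℕ) (x : Fin 2 → ℝ) : bump N x ≤ 1 := (min_le_left _ _).trans (tent_le_one _)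

lemma bump_le (N : ℕ) (x : Fin 2 → ℝ) (i : Fin 2) : bump N x ≤ tent (N * x i) := by
  fin_cases i
  · exact min_le_left _ _
  · exact min_le_right _ _

lemma bump_lip (N : ℕ) (hN : 0 < N) (p : (Fin 2 → ℤ) → (Fin 2 → ℝ)) (c : ℝ)
    (hp : ∀ k, ‖p k‖ ≤ c / (2 * N)) (x y : Fin 2 → ℝ) :
    ‖bump N x • p (cellOf N x) - bump N y • p (cellOf N y)‖ ≤ c * ‖x - y‖ := by
  have hN' : (0 : ℝ) < N := by exact_mod_cast hN
  have hmul : ∀ i, |(N : ℝ) * x i - N * y i| ≤ N * ‖x - y‖ := by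
    intro i
    rw [← mul_sub, abs_mul, abs_of_pos hN']
    gcongr
    exact norm_le_pi_norm (x - y) i
  have hc0 : 0 ≤ c / (2 * N) := (norm_nonneg _).trans (hp 0)
  by_cases h : cellOf N x = cellOf N y
  · rw [h, ← sub_smul, norm_smul]
    have h0 := (tent_same _ _ (congrFun h 0)).trans (mul_le_mul_of_nonneg_left (hmul 0) (by norm_num))
    have h1 := (tent_same _ _ (congrFun h 1)).trans (mul_le_mul_of_nonneg_left (hmul 1) (by norm_num))
    have h2 : ‖bump N x - bump N y‖ ≤ 2 * (N * ‖x - y‖) :=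
      (abs_min_sub_min_le_max _ _ _ _).trans (max_le h0 h1)
    calc _ ≤ (2 * (N * ‖x - y‖)) * (c / (2 * N)) := by gcongr; exact hp _
      _ = c * ‖x - y‖ := by field_simp
  · obtain ⟨i, hi⟩ := Function.ne_iff.1 h
    have h1 := (tent_diff _ _ hi).trans (mul_le_mul_of_nonneg_left (hmul i) (by norm_num))
    have h2 := bump_le N x i
    have h3 := bump_le N y i
    refine (norm_sub_le _ _).trans ?_
    rw [norm_smul, norm_smul, Real.norm_of_nonneg (bump_nonneg _ _),
      Real.norm_of_nonneg (bump_nonneg _ _)]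
    have h4 : bump N x * ‖p (cellOf N x)‖ ≤ bump N x * (c / (2 * N)) := by
      gcongr
      · exact bump_nonneg _ _
      · exact hp _
    have h5 : bump N y * ‖p (cellOf N y)‖ ≤ bump N y * (c / (2 * N)) := by
      gcongr
      · exact bump_nonneg _ _
      · exact hp _
    calc _ ≤ (bump N x + bump N y) * (c / (2 * N)) := by linarith
      _ ≤ (2 * (N * ‖x - y‖)) * (c / (2 * N)) := by gcongr; linarith
      _ = c * ‖x - y‖ := by field_simp

lemma exists_homeo_of_lip (u : (Fin 2 → ℝ) → (Fin 2 → ℝ)) (c : ℝ) (hc0 : 0 ≤ c) (hc1 : c < 1)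
    (hu : ∀ x y, ‖u x - u y‖ ≤ c * ‖x - y‖) :
    ∃ H : (Fin 2 → ℝ) ≃ₜ (Fin 2 → ℝ), ∀ x, H x = x + u x := by
  have ha : ApproximatesLinearOn (fun x => x + u x)
      ((ContinuousLinearEquiv.refl ℝ (Fin 2 → ℝ)) : (Fin 2 → ℝ) →L[ℝ] (Fin 2 → ℝ)) univ
      ⟨c, hc0⟩ := by
    intro x _ y _
    have : x + u x - (y + u y) - (x - y) = u x - u y := by abel
    simp only [ContinuousLinearEquiv.coe_refl, ContinuousLinearMap.coe_id', id]
    rw [this]; exact hu x y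
  refine ⟨ha.toHomeomorph _ (Or.inr ?_), fun x => rfl⟩
  have h1 : ‖(((ContinuousLinearEquiv.refl ℝ (Fin 2 → ℝ)).symm :
      (Fin 2 → ℝ) ≃L[ℝ] (Fin 2 → ℝ)) : (Fin 2 → ℝ) →L[ℝ] (Fin 2 → ℝ))‖₊ = 1 := by
    apply NNReal.eq
    exact ContinuousLinearMap.norm_id
  rw [h1, inv_one]
  exact hc1

def ctr (N : ℕ) (k : Fin 2 → ℤ) : R2 := WithLp.toLp 2 (fun i => ((k i : ℝ) + 1 / 2) / N)

lemma cellHomeo (N : ℕ) (hN : 0 < N) (p : (Fin 2 → ℤ) → R2) (c : ℝ) (hc0 : 0 ≤ c) (hc1 : c < 1)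
    (hp : ∀ k i, |p k i| ≤ c / (2 * N)) (hper : ∀ k w : Fin 2 → ℤ, p (k + (N : ℤ) • w) = p k) :
    ∃ H : R2 ≃ₜ R2, Eqv H ∧ (∀ k, H (ctr N k) = ctr N k + p k) ∧ ∀ x, ‖H x - x‖ ≤ 1 / N := by
  have hN' : (0 : ℝ) < N := by exact_mod_cast hN
  set p' : (Fin 2 → ℤ) → (Fin 2 → ℝ) := fun k => WithLp.ofLp (p k) with hp'
  have hpn : ∀ k, ‖p' k‖ ≤ c / (2 * N) := fun k =>
    (pi_norm_le_iff_of_nonneg (by positivity)).2 (fun i => hp k i)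
  obtain ⟨H, hH⟩ := exists_homeo_of_lip (fun x => bump N x • p' (cellOf N x)) c hc0 hc1
    (bump_lip N hN p' c hpn)
  let e : R2 ≃ₜ (Fin 2 → ℝ) := (EuclideanSpace.equiv (Fin 2) ℝ).toHomeomorph
  have hE : ∀ x : R2, (e.trans (H.trans e.symm)) x =
      x + bump N (WithLp.ofLp x) • p (cellOf N (WithLp.ofLp x)) := by
    intro x
    apply e.injective
    simp only [Homeomorph.trans_apply, Homeomorph.apply_symm_apply, hH]
    rfl
  refine ⟨e.trans (H.trans e.symm), ?_, ?_, ?_⟩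
  · intro x w hw
    rw [hE, hE]
    choose n hn using hw
    have hcell : cellOf N (WithLp.ofLp (x + w)) = cellOf N (WithLp.ofLp x) + (N : ℤ) • n := by
      ext i
      simp only [cellOf, PiLp.add_apply, Pi.add_apply, Pi.smul_apply, hn, smul_eq_mul]
      rw [← Int.floor_add_intCast]; push_cast; congr 1; ring
    have hb : bump N (WithLp.ofLp (x + w)) = bump N (WithLp.ofLp x) := by
      have : ∀ i, tent (N * (x + w) i) = tent (N * x i) := by
        intro i
        unfold tent
        have : (N : ℝ) * (x + w) i = N * x i + ((N * n i : ℤ) : ℝ) := by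
          simp only [PiLp.add_apply, hn]; push_cast; ring
        rw [this, Int.fract_add_intCast]
      unfold bump; rw [this, this]
    rw [hcell, hb, hper]; abel
  · intro k
    rw [hE]
    have h1 : ∀ i, (N : ℝ) * (ctr N k) i = k i + 1 / 2 := by
      intro i; simp only [ctr]; field_simp
    have hcell : cellOf N (WithLp.ofLp (ctr N k)) = k := by
      ext i
      simp only [cellOf, h1]
      rw [Int.floor_intCast_add]; norm_num
    have hb : bump N (WithLp.ofLp (ctr N k)) = 1 := by
      unfold bump; rw [h1, h1, tent_half, tent_half, min_self]
    rw [hcell, hb, one_smul]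
  · intro x
    rw [hE, add_sub_cancel_left]
    refine (norm_le_R2 _).trans ?_
    have h1 := bump_nonneg N (WithLp.ofLp x)
    have h2 := bump_le_one N (WithLp.ofLp x)
    have hb : ∀ i, |(bump N (WithLp.ofLp x) • p (cellOf N (WithLp.ofLp x))) i| ≤ 1 / (2 * N) := by
      intro i
      simp only [PiLp.smul_apply, smul_eq_mul]
      rw [abs_mul, abs_of_nonneg h1]
      have h3 := hp (cellOf N (WithLp.ofLp x)) i
      calc _ ≤ 1 * (c / (2 * N)) := by gcongr
        _ ≤ 1 / (2 * N) := by rw [one_mul]; gcongr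
    have e : (1 : ℝ) / N = 1 / (2 * N) + 1 / (2 * N) := by field_simp; norm_num
    rw [e]
    exact add_le_add (hb 0) (hb 1)

lemma Eqv.symm {G : R2 ≃ₜ R2} (h : Eqv G) : Eqv G.symm := by
  intro x w hw
  apply G.injective
  rw [h _ w hw]; simp

def descFun (G : R2 ≃ₜ R2) (h : Eqv G) : T2 → T2 :=
  Quotient.lift (fun x => pr (G x)) (by
    intro a b hab
    have h1 : -a + b ∈ intLattice := QuotientAddGroup.leftRel_apply.1 hab
    have h2 : b = a + (-a + b) := by abel
    refine QuotientAddGroup.eq.2 ?_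
    rw [h2, h _ _ h1]
    simpa using h1)

lemma descFun_pr (G : R2 ≃ₜ R2) (h : Eqv G) (x : R2) : descFun G h (pr x) = pr (G x) := rfl

lemma continuous_descFun (G : R2 ≃ₜ R2) (h : Eqv G) : Continuous (descFun G h) := by
  apply Continuous.quotient_lift
  exact continuous_quotient_mk'.comp G.continuous

lemma pr_surj (t : T2) : ∃ x, pr x = t := QuotientAddGroup.mk_surjective t

lemma exists_desc (G : R2 ≃ₜ R2) (h : Eqv G) : ∃ g : T2 ≃ₜ T2, IsLift g G := by
  refine ⟨{ toFun := descFun G h, invFun := descFun G.symm h.symm, left_inv := ?_, right_inv := ?_,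
            continuous_toFun := continuous_descFun G h,
            continuous_invFun := continuous_descFun _ _ }, fun x => rfl, h⟩
  · intro t
    obtain ⟨x, rfl⟩ := pr_surj t
    rw [descFun_pr, descFun_pr]; simp
  · intro t
    obtain ⟨x, rfl⟩ := pr_surj t
    rw [descFun_pr, descFun_pr]; simp

def latt (w : Fin 2 → ℤ) : R2 := WithLp.toLp 2 (fun i => (w i : ℝ))

lemma latt_mem (w : Fin 2 → ℤ) : latt w ∈ intLattice := fun i => ⟨w i, rfl⟩

def inCell (N : ℕ) (k : Fin 2 → ℤ) (x : R2) : Prop := ∀ i, |x i - ctr N k i| < 1 / (2 * N)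

lemma ctr_add (N : ℕ) (hN : 0 < N) (k w : Fin 2 → ℤ) : ctr N (k + (N : ℤ) • w) = ctr N k + latt w := by
  have : (N : ℝ) ≠ 0 := by positivity
  ext i
  simp [ctr, latt]
  field_simp
  ring

lemma inCell_add {N : ℕ} (hN : 0 < N) {k : Fin 2 → ℤ} {x : R2} (h : inCell N k x) (w : Fin 2 → ℤ) :
    inCell N (k + (N : ℤ) • w) (x + latt w) := by
  intro i
  rw [ctr_add N hN]
  have := h i
  simpa using this

lemma unif_c (N : ℕ) (hN : 0 < N) (K : ℕ → Fin 2 → ℤ) (X : ℕ → R2) (m : ℕ)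
    (hX : ∀ j < m, inCell N (K j) (X j)) :
    ∃ c : ℝ, 0 ≤ c ∧ c < 1 ∧ ∀ j < m, ∀ i, |(X j - ctr N (K j)) i| ≤ c / (2 * N) := by
  have hN' : (0 : ℝ) < N := by exact_mod_cast hN
  induction m with
  | zero => exact ⟨0, le_rfl, one_pos, fun j hj => absurd hj (Nat.not_lt_zero _)⟩
  | succ m ih =>
    obtain ⟨c, h0, h1, h2⟩ := ih (fun j hj => hX j (by omega))
    have h3 : ∀ i, 2 * N * |(X m - ctr N (K m)) i| < 1 := by
      intro i
      have := hX m (by omega) i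
      rw [lt_div_iff₀ (by positivity)] at this
      simp only [PiLp.sub_apply]
      linarith
    refine ⟨max c (max (2 * N * |(X m - ctr N (K m)) 0|) (2 * N * |(X m - ctr N (K m)) 1|)),
      le_max_of_le_left h0, max_lt h1 (max_lt (h3 0) (h3 1)), ?_⟩
    intro j hj i
    rcases Nat.lt_succ_iff_lt_or_eq.1 hj with hj | rfl
    · refine (h2 j hj i).trans ?_
      gcongr
      exact le_max_left _ _
    · rw [le_div_iff₀ (by positivity)]
      refine le_trans ?_ (le_max_right _ _)
      fin_cases i
      · refine le_trans ?_ (le_max_left _ _)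
        simp only [Fin.zero_eta]; linarith
      · refine le_trans ?_ (le_max_right _ _)
        simp only [Fin.mk_one]; linarith

open Classical in
lemma ptsHomeo (N : ℕ) (hN : 0 < N) (K : ℕ → Fin 2 → ℤ) (X : ℕ → R2) (m : ℕ)
    (hK : ∀ a b, a < b → b < m → ∀ u : Fin 2 → ℤ, K b ≠ K a + (N : ℤ) • u)
    (hX : ∀ j < m, inCell N (K j) (X j)) :
    ∃ H : R2 ≃ₜ R2, Eqv H ∧ (∀ j < m, H (ctr N (K j)) = X j) ∧ ∀ x, ‖H x - x‖ ≤ 1 / N := by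
  have hN' : (0 : ℝ) < N := by exact_mod_cast hN
  obtain ⟨c, h0, h1, h2⟩ := unif_c N hN K X m hX
  set p : (Fin 2 → ℤ) → R2 := fun κ => ∑ j ∈ Finset.range m,
    if ∃ u : Fin 2 → ℤ, κ = K j + (N : ℤ) • u then X j - ctr N (K j) else 0 with hp
  have huniq : ∀ (κ : Fin 2 → ℤ) (j : ℕ), j < m → (∃ u : Fin 2 → ℤ, κ = K j + (N : ℤ) • u) →
      p κ = X j - ctr N (K j) := by
    rintro κ j hj ⟨u, hu⟩
    rw [hp]
    dsimp only
    rw [Finset.sum_eq_single j]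
    · rw [if_pos ⟨u, hu⟩]
    · intro b hb hbj
      rw [if_neg]
      rintro ⟨v, hv⟩
      rw [Finset.mem_range] at hb
      rcases lt_or_gt_of_ne hbj with h | h
      · refine hK b j h hj (v - u) ?_
        rw [smul_sub, ← add_sub_assoc, ← hv, hu]; abel
      · refine hK j b h hb (u - v) ?_
        rw [smul_sub, ← add_sub_assoc, ← hu, hv]; abel
    · intro h; exact absurd (Finset.mem_range.2 hj) h
  obtain ⟨H, hH, hH1, hH2⟩ := cellHomeo N hN p c h0 h1 (by
    intro κ i
    by_cases h : ∃ j < m, ∃ u : Fin 2 → ℤ, κ = K j + (N : ℤ) • u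
    · obtain ⟨j, hj, hu⟩ := h
      rw [huniq κ j hj hu]
      exact h2 j hj i
    · have : p κ = 0 := by
        rw [hp]
        refine Finset.sum_eq_zero fun j hj => ?_
        rw [if_neg]
        intro hu
        exact h ⟨j, Finset.mem_range.1 hj, hu⟩
      rw [this]
      simp
      positivity) (by
    intro κ w
    rw [hp]
    dsimp only
    refine Finset.sum_congr rfl fun j hj => ?_
    congr 1
    apply propext
    constructor
    · rintro ⟨u, hu⟩
      refine ⟨u - w, ?_⟩
      rw [smul_sub, ← add_sub_assoc, ← hu]; abel
    · rintro ⟨u, hu⟩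
      refine ⟨u + w, ?_⟩
      rw [smul_add, ← add_assoc, ← hu])
  refine ⟨H, hH, ?_, hH2⟩
  intro j hj
  rw [hH1, huniq _ j hj ⟨0, by simp⟩]
  abel

lemma rot_of_periodic (G : R2 ≃ₜ R2) (hG : Eqv G) (m : ℕ) (hm : 1 ≤ m) (y w : R2) (hw : w ∈ intLattice)
    (h : G^[m] y = y + w) : (m : ℝ)⁻¹ • w ∈ rotSet G := by
  have key : ∀ n : ℕ, G^[m * n] y = y + (n : ℝ) • w := by
    intro n
    induction n with
    | zero => simp
    | succ n ih =>
      have hn : (n : ℝ) • w ∈ intLattice := by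
        rw [Nat.cast_smul_eq_nsmul]; exact intLattice.nsmul_mem hw n
      rw [mul_add, mul_one, add_comm, Function.iterate_add_apply, ih, hG.iterate m _ _ hn, h]
      push_cast
      rw [add_smul, one_smul]; abel
  refine ⟨fun _ => y, fun n => m * (n + 1), ?_, ?_⟩
  · refine tendsto_atTop_mono (fun n => ?_) tendsto_id
    simp only [id]
    nlinarith
  · refine tendsto_const_nhds.congr fun n => ?_
    rw [key, add_sub_cancel_left, smul_smul]
    congr 1
    have : (m : ℝ) ≠ 0 := by positivity
    push_cast
    have : (n : ℝ) + 1 ≠ 0 := by positivity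
    field_simp

lemma cycle_mem (F : R2 ≃ₜ R2) (hF : Eqv F) (δ : ℝ) (hst : StableRS Homeo0 F δ)
    (N : ℕ) (hN : 0 < N) (hδ : 2 / (N : ℝ) < δ) (m : ℕ) (hm : 1 ≤ m)
    (k : ℕ → Fin 2 → ℤ) (w : Fin 2 → ℤ) (hkm : k m = k 0 + (N : ℤ) • w)
    (hinj : ∀ a b, a < b → b < m → ∀ u : Fin 2 → ℤ, k b ≠ k a + (N : ℤ) • u)
    (hwalk : ∀ i < m, ∃ y, inCell N (k i) y ∧ inCell N (k (i + 1)) (F y)) :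
    (m : ℝ)⁻¹ • latt w ∈ rotSet F := by
  choose! y hy hFy using hwalk
  set Y : ℕ → R2 := fun i => if i < m then y i else y 0 + latt w with hY
  have hYlt : ∀ i < m, Y i = y i := fun i hi => if_pos hi
  have hYm : Y m = y 0 + latt w := if_neg (lt_irrefl m)
  have hYc : ∀ i ≤ m, inCell N (k i) (Y i) := by
    intro i hi
    rcases hi.lt_or_eq with h | rfl
    · rw [hYlt i h]; exact hy i h
    · rw [hYm, hkm]; exact inCell_add hN (hy 0 (by omega)) w
  have hK : ∀ a b, a < b → b < m → ∀ u : Fin 2 → ℤ, k (b + 1) ≠ k (a + 1) + (N : ℤ) • u := by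
    intro a b hab hb u he
    rcases Nat.lt_or_ge (b + 1) m with h | h
    · exact hinj (a + 1) (b + 1) (by omega) h u he
    · have hbm : b + 1 = m := by omega
      rw [hbm, hkm] at he
      refine hinj 0 (a + 1) (by omega) (by omega) (w - u) ?_
      rw [smul_sub, ← add_sub_assoc, he]; abel
  obtain ⟨P, hP, hP1, hP2⟩ := ptsHomeo N hN (fun j => k (j + 1)) (fun j => F (y j)) m hK hFy
  obtain ⟨Q, hQ, hQ1, hQ2⟩ := ptsHomeo N hN (fun j => k (j + 1)) (fun j => Y (j + 1)) m hK
    (fun j hj => hYc (j + 1) hj)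
  set G : R2 ≃ₜ R2 := F.trans (P.symm.trans Q) with hG
  have hGx : ∀ x, G x = Q (P.symm (F x)) := fun x => rfl
  have hGe : Eqv G := by
    intro x v hv
    rw [hGx, hGx, hF x v hv, hP.symm _ v hv, hQ _ v hv]
  have hstep : ∀ j < m, G (Y j) = Y (j + 1) := by
    intro j hj
    rw [hGx, hYlt j hj, ← hQ1 j hj, ← hP1 j hj, P.symm_apply_apply]
  have hit : ∀ j ≤ m, G^[j] (Y 0) = Y j := by
    intro j
    induction j with
    | zero => intro _; rfl
    | succ j ih =>
      intro hj
      rw [Function.iterate_succ_apply', ih (by omega), hstep j (by omega)]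
  have hmem : (m : ℝ)⁻¹ • latt w ∈ rotSet G := by
    refine rot_of_periodic G hGe m hm (Y 0) _ (latt_mem w) ?_
    rw [hit m le_rfl, hYm, hYlt 0 (by omega)]
  obtain ⟨g, hg⟩ := exists_desc G hGe
  have hd : supDist F G < δ := by
    refine lt_of_le_of_lt (ciSup_le fun x => ?_) hδ
    have h1 := hP2 (P.symm (F x))
    have h2 := hQ2 (P.symm (F x))
    rw [P.apply_symm_apply] at h1
    rw [dist_eq_norm, hGx]
    calc ‖F x - Q (P.symm (F x))‖ = ‖(F x - P.symm (F x)) - (Q (P.symm (F x)) - P.symm (F x))‖ := by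
          congr 1; abel
      _ ≤ _ := norm_sub_le _ _
      _ ≤ 1 / N + 1 / N := add_le_add h1 h2
      _ = 2 / N := by ring
  rw [← hst g ⟨G, hg⟩ G hg hd]
  exact hmem

lemma norm_ctr_inCell {N : ℕ} (hN : 0 < N) {k : Fin 2 → ℤ} {x : R2} (h : inCell N k x) :
    ‖x - ctr N k‖ ≤ 1 := by
  have h1 : (1 : ℝ) ≤ N := by exact_mod_cast hN
  have h2 : 1 / (2 * (N : ℝ)) ≤ 1 / 2 := by
    apply one_div_le_one_div_of_le <;> linarith
  have h3 := norm_le_R2 (x - ctr N k)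
  have h4 := h 0
  have h5 := h 1
  simp only [PiLp.sub_apply] at h3
  linarith

def IsWalk (F : R2 → R2) (N n : ℕ) (k : ℕ → Fin 2 → ℤ) : Prop :=
  ∀ i < n, ∃ y, inCell N (k i) y ∧ inCell N (k (i + 1)) (F y)

lemma walk_disp {F : R2 → R2} {N : ℕ} (hN : 0 < N) {B : ℝ} (hB : ∀ z, ‖F z - z‖ ≤ B) (n : ℕ)
    (k : ℕ → Fin 2 → ℤ) (hk : IsWalk F N n k) : ‖ctr N (k n) - ctr N (k 0)‖ ≤ n * (B + 2) := by
  induction n with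
  | zero => simp
  | succ n ih =>
    have h1 := ih (fun i hi => hk i (by omega))
    obtain ⟨y, hy1, hy2⟩ := hk n (by omega)
    have h2 := norm_ctr_inCell hN hy1
    have h3 := norm_ctr_inCell hN hy2
    have h4 := hB y
    have e : ctr N (k (n + 1)) - ctr N (k 0) =
      (ctr N (k n) - ctr N (k 0)) + (F y - y) + (y - ctr N (k n)) - (F y - ctr N (k (n + 1))) := by abel
    rw [e]
    push_cast
    refine (norm_sub_le _ _).trans ?_
    have h5 := norm_add_le ((ctr N (k n) - ctr N (k 0)) + (F y - y)) (y - ctr N (k n))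
    have h6 := norm_add_le (ctr N (k n) - ctr N (k 0)) (F y - y)
    linarith

lemma exists_simple (N : ℕ) (hN : 0 < N) (k : ℕ → Fin 2 → ℤ) :
    ∃ d a, 1 ≤ d ∧ a + d ≤ N ^ 2 ∧ (∃ u : Fin 2 → ℤ, k (a + d) = k a + (N : ℤ) • u) ∧
      ∀ s t, s < t → t < d → ∀ u : Fin 2 → ℤ, k (a + t) ≠ k (a + s) + (N : ℤ) • u := by
  classical
  haveI : NeZero N := ⟨hN.ne'⟩
  have hex : ∃ d, 1 ≤ d ∧ ∃ a, a + d ≤ N ^ 2 ∧ ∃ u : Fin 2 → ℤ, k (a + d) = k a + (N : ℤ) • u := by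
    have hcard : Fintype.card (Fin 2 → ZMod N) < Fintype.card (Fin (N ^ 2 + 1)) := by
      simp [ZMod.card]
    obtain ⟨x, y, hxy, he⟩ := Fintype.exists_ne_map_eq_of_card_lt
      (fun (i : Fin (N ^ 2 + 1)) => (fun j => (k i j : ZMod N) : Fin 2 → ZMod N)) hcard
    wlog hlt : x < y generalizing x y with H
    · exact H y x hxy.symm he.symm (lt_of_le_of_ne (not_lt.1 hlt) hxy.symm)
    have hlt' : (x : ℕ) < y := hlt
    refine ⟨y - x, by omega, x, by omega, ?_⟩
    have hd : ∀ j, ∃ c : ℤ, k y j - k x j = N * c := by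
      intro j
      have := congrFun he j
      exact (ZMod.intCast_eq_intCast_iff_dvd_sub _ _ _).1 this
    choose u hu using hd
    refine ⟨u, ?_⟩
    have : (x : ℕ) + (y - x) = y := by omega
    rw [this]
    funext j
    simp only [Pi.add_apply, Pi.smul_apply, smul_eq_mul]
    have := hu j
    linarith
  obtain ⟨h1, a, h2, h3⟩ := Nat.find_spec hex
  refine ⟨Nat.find hex, a, h1, h2, h3, ?_⟩
  intro s t hst ht u hu
  refine Nat.find_min hex (m := t - s) (by omega) ⟨by omega, a + s, by omega, u, ?_⟩
  have : a + s + (t - s) = a + t := by omega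
  rw [this, hu]

lemma walk_bound {F : R2 → R2} (hF : Eqv F) {N : ℕ} (hN : 0 < N) {B : ℝ} (hB : ∀ z, ‖F z - z‖ ≤ B)
    (l : R2 →L[ℝ] ℝ) (α : ℝ)
    (hcyc : ∀ m, 1 ≤ m → m ≤ N ^ 2 → ∀ (k : ℕ → Fin 2 → ℤ) (w : Fin 2 → ℤ),
      k m = k 0 + (N : ℤ) • w →
      (∀ a b, a < b → b < m → ∀ u : Fin 2 → ℤ, k b ≠ k a + (N : ℤ) • u) → IsWalk F N m k →
      l (latt w) ≤ α * m) (n : ℕ) :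
    ∀ k, IsWalk F N n k → l (ctr N (k n) - ctr N (k 0)) ≤
      α * n + (N ^ 2 : ℕ) * (‖l‖ * (B + 2) + |α|) := by
  have hB0 : 0 ≤ B := (norm_nonneg _).trans (hB 0)
  induction n using Nat.strong_induction_on with
  | _ n ih =>
  intro k hk
  rcases Nat.lt_or_ge n (N ^ 2) with hn | hn
  · have h1 := walk_disp hN hB n k hk
    have h2 := (le_abs_self _).trans (l.le_opNorm (ctr N (k n) - ctr N (k 0)))
    have h3 : ‖l‖ * ‖ctr N (k n) - ctr N (k 0)‖ ≤ ‖l‖ * (n * (B + 2)) := by gcongr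
    have h4 : (n : ℝ) ≤ (N ^ 2 : ℕ) := by exact_mod_cast hn.le
    have h5 : (n : ℝ) * (‖l‖ * (B + 2) + |α|) ≤ (N ^ 2 : ℕ) * (‖l‖ * (B + 2) + |α|) := by gcongr
    have h6 : 0 ≤ (n : ℝ) * (α + |α|) := by
      have := neg_abs_le α
      apply mul_nonneg (by positivity); linarith
    have h7 : l (ctr N (k n) - ctr N (k 0)) ≤ ‖l‖ * (n * (B + 2)) := h2.trans h3
    linarith
  · obtain ⟨d, a, hd1, hda, ⟨u, hu⟩, hs⟩ := exists_simple N hN k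
    have hlu : l (latt u) ≤ α * d := by
      refine hcyc d hd1 (by omega) (fun t => k (a + t)) u hu hs ?_
      intro i hi
      exact hk (a + i) (by omega)
    set k' : ℕ → Fin 2 → ℤ := fun t => if t ≤ a then k t else k (t + d) + (N : ℤ) • (-u) with hk'
    have hge : ∀ t, a ≤ t → k' t = k (t + d) + (N : ℤ) • (-u) := by
      intro t ht
      rcases ht.lt_or_eq with h | rfl
      · exact if_neg (by omega)
      · rw [hk']; simp only [le_refl, if_true]; rw [hu, smul_neg]; abel
    have hle : ∀ t, t ≤ a → k' t = k t := fun t ht => if_pos ht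
    have hw' : IsWalk F N (n - d) k' := by
      intro i hi
      rcases Nat.lt_or_ge i a with h | h
      · rw [hle i h.le, hle (i + 1) h]; exact hk i (by omega)
      · rw [hge i h, hge (i + 1) (by omega)]
        obtain ⟨y, hy1, hy2⟩ := hk (i + d) (by omega)
        refine ⟨y + latt (-u), inCell_add hN hy1 _, ?_⟩
        rw [hF _ _ (latt_mem _)]
        have : i + 1 + d = i + d + 1 := by omega
        rw [this]
        exact inCell_add hN hy2 _
    have h1 := ih (n - d) (by omega) k' hw'
    rw [hle 0 (by omega), hge (n - d) (by omega), ctr_add N hN] at h1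
    have h2 : n - d + d = n := by omega
    have h3 : latt (-u) = - latt u := by ext i; simp [latt]
    have h4 : ((n - d : ℕ) : ℝ) = n - d := Nat.cast_sub (by omega)
    rw [h2, h3, h4] at h1
    have e : l (ctr N (k n) - ctr N (k 0)) = l (ctr N (k n) + -latt u - ctr N (k 0)) + l (latt u) := by
      rw [← map_add]; congr 1; abel
    rw [e]
    linarith

def goodSet (N : ℕ) : Set R2 := {x | ∀ i, (N : ℝ) * x i ∉ range ((↑) : ℤ → ℝ)}

lemma goodSet_aux (N : ℕ) (hN : 0 < N) (i : Fin 2) :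
    IsOpen {x : R2 | (N : ℝ) * x i ∉ range ((↑) : ℤ → ℝ)} ∧
    Dense {x : R2 | (N : ℝ) * x i ∉ range ((↑) : ℤ → ℝ)} := by
  have hN' : (N : ℝ) ≠ 0 := by positivity
  set S : Set ℝ := {t | (N : ℝ) * t ∉ range ((↑) : ℤ → ℝ)} with hS
  have hSo : IsOpen S := by
    have : IsClosed (range ((↑) : ℤ → ℝ)) := Int.isClosedEmbedding_coe_real.isClosed_range
    exact this.isOpen_compl.preimage (continuous_const.mul continuous_id)
  have hSd : Dense S := by
    have : (((fun t : ℝ => (N : ℝ) * t) ⁻¹' (range ((↑) : ℤ → ℝ))) : Set ℝ).Countable :=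
      (countable_range _).preimage_of_injOn (mul_right_injective₀ hN').injOn
    exact this.dense_compl ℝ
  have hop : IsOpenMap (EuclideanSpace.proj i : R2 →L[ℝ] ℝ) := by
    apply ContinuousLinearMap.isOpenMap
    intro t
    exact ⟨WithLp.toLp 2 (fun _ => t), rfl⟩
  exact ⟨hSo.preimage (EuclideanSpace.proj i : R2 →L[ℝ] ℝ).continuous, hSd.preimage hop⟩

lemma goodSet_open_dense (N : ℕ) (hN : 0 < N) : IsOpen (goodSet N) ∧ Dense (goodSet N) := by
  have e : goodSet N = {x : R2 | (N : ℝ) * x 0 ∉ range ((↑) : ℤ → ℝ)} ∩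
      {x : R2 | (N : ℝ) * x 1 ∉ range ((↑) : ℤ → ℝ)} := by
    ext x; simp only [goodSet, mem_setOf_eq, Fin.forall_fin_two, mem_inter_iff]
  rw [e]
  have h0 := goodSet_aux N hN 0
  have h1 := goodSet_aux N hN 1
  exact ⟨h0.1.inter h1.1, h0.2.inter_of_isOpen_left h1.2 h0.1⟩

lemma goodOrbit (F : R2 ≃ₜ R2) (N : ℕ) (hN : 0 < N) (n : ℕ) :
    IsOpen {z | ∀ i ≤ n, F^[i] z ∈ goodSet N} ∧ Dense {z | ∀ i ≤ n, F^[i] z ∈ goodSet N} := by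
  obtain ⟨ho, hd⟩ := goodSet_open_dense N hN
  induction n with
  | zero => simpa using ⟨ho, hd⟩
  | succ n ih =>
    have e : {z | ∀ i ≤ n + 1, F^[i] z ∈ goodSet N} =
        goodSet N ∩ F ⁻¹' {z | ∀ i ≤ n, F^[i] z ∈ goodSet N} := by
      ext z
      simp only [mem_setOf_eq, mem_inter_iff, mem_preimage]
      constructor
      · intro h
        exact ⟨h 0 (by omega), fun i hi => h (i + 1) (by omega)⟩
      · rintro ⟨h0, h1⟩ i hi
        rcases i with _ | i
        · exact h0
        · exact h1 i (by omega)
    rw [e]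
    exact ⟨ho.inter (ih.1.preimage F.continuous),
      hd.inter_of_isOpen_left (ih.2.preimage F.isOpenMap) ho⟩

lemma inCell_good (N : ℕ) (hN : 0 < N) (x : R2) (hx : x ∈ goodSet N) :
    inCell N (fun i => ⌊(N : ℝ) * x i⌋) x := by
  have hN' : (0 : ℝ) < N := by exact_mod_cast hN
  intro i
  have h1 := Int.floor_le ((N : ℝ) * x i)
  have h2 := Int.lt_floor_add_one ((N : ℝ) * x i)
  have h3 : (⌊(N : ℝ) * x i⌋ : ℝ) < N * x i := lt_of_le_of_ne h1 fun h => hx i ⟨_, h⟩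
  have e : x i - ctr N (fun i => ⌊(N : ℝ) * x i⌋) i = ((N : ℝ) * x i - ⌊(N : ℝ) * x i⌋ - 1 / 2) / N := by
    simp only [ctr]; field_simp; ring
  rw [e, abs_div, abs_of_pos hN', div_lt_div_iff₀ hN' (by positivity)]
  have : |(N : ℝ) * x i - ⌊(N : ℝ) * x i⌋ - 1 / 2| < 1 / 2 := abs_lt.2 ⟨by linarith, by linarith⟩
  nlinarith

lemma orbit_bound (F : R2 ≃ₜ R2) {N : ℕ} (hN : 0 < N) (l : R2 →L[ℝ] ℝ) (α C : ℝ)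
    (h : ∀ n k, IsWalk F N n k → l (ctr N (k n) - ctr N (k 0)) ≤ α * n + C) (n : ℕ) (z : R2) :
    l (F^[n] z - z) ≤ α * n + (C + ‖l‖ * 4) := by
  obtain ⟨ho, hd⟩ := goodOrbit F N hN n
  have hopen : IsOpen {x | dist x z < 1 ∧ dist (F^[n] x) (F^[n] z) < 1} :=
    (isOpen_lt (continuous_id.dist continuous_const) continuous_const).inter
      (isOpen_lt ((F.continuous.iterate n).dist continuous_const) continuous_const)
  obtain ⟨x, ⟨hx1, hx2⟩, hx⟩ := hd.inter_open_nonempty _ hopen ⟨z, by simp⟩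
  set k : ℕ → Fin 2 → ℤ := fun i j => ⌊(N : ℝ) * (F^[i] x) j⌋ with hk
  have hc : ∀ i ≤ n, inCell N (k i) (F^[i] x) := fun i hi => inCell_good N hN _ (hx i hi)
  have hw : IsWalk F N n k := by
    intro i hi
    refine ⟨F^[i] x, hc i hi.le, ?_⟩
    rw [← Function.iterate_succ_apply' F]
    exact hc (i + 1) hi
  have h1 := h n k hw
  have h2 := norm_ctr_inCell hN (hc n le_rfl)
  have h3 := norm_ctr_inCell hN (hc 0 (by omega))
  rw [dist_eq_norm] at hx1 hx2
  set e : R2 := (F^[n] z - z) - (ctr N (k n) - ctr N (k 0)) with he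
  have he4 : ‖e‖ ≤ 4 := by
    have : e = (F^[n] x - ctr N (k n)) - (F^[n] x - F^[n] z) - (F^[0] x - ctr N (k 0)) + (x - z) := by
      rw [he]; simp only [Function.iterate_zero, id]; abel
    rw [this]
    have a1 := norm_add_le ((F^[n] x - ctr N (k n)) - (F^[n] x - F^[n] z) - (F^[0] x - ctr N (k 0))) (x - z)
    have a2 := norm_sub_le ((F^[n] x - ctr N (k n)) - (F^[n] x - F^[n] z)) (F^[0] x - ctr N (k 0))
    have a3 := norm_sub_le (F^[n] x - ctr N (k n)) (F^[n] x - F^[n] z)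
    linarith
  have h5 := (le_abs_self _).trans (l.le_opNorm e)
  have h6 : ‖l‖ * ‖e‖ ≤ ‖l‖ * 4 := by gcongr
  have e2 : l (F^[n] z - z) = l (ctr N (k n) - ctr N (k 0)) + l e := by
    rw [← map_add, he]; congr 1; abel
  have h5' : l e ≤ ‖l‖ * ‖e‖ := h5
  rw [e2]; linarith

lemma polygon_of_stable (F : R2 ≃ₜ R2) (hF : Eqv F) (δ : ℝ) (hδ : 0 < δ) (hst : StableRS Homeo0 F δ) :
    ∃ V : Finset R2, (∀ v ∈ V, IsRationalPoint v) ∧ rotSet F = convexHull ℝ (V : Set R2) := by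
  obtain ⟨B, hB0, hB⟩ := exists_disp_bound F F.continuous hF
  obtain ⟨M, hM⟩ := exists_nat_gt (2 / δ)
  have hM0 : (0 : ℝ) < M := lt_trans (by positivity) hM
  set N := M with hNM
  have hN : 0 < N := by exact_mod_cast hM0
  have hδN : 2 / (N : ℝ) < δ := by
    rw [div_lt_iff₀ hM0]; rw [div_lt_iff₀ hδ] at hM; linarith
  obtain ⟨D, hD⟩ := exists_nat_gt ((N ^ 2 : ℕ) * (B + 2))
  set W : Set R2 := (fun q : ℕ × (Fin 2 → ℤ) => (q.1 : ℝ)⁻¹ • latt q.2) ''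
    (Set.Icc 1 (N ^ 2) ×ˢ Set.Icc (fun _ => -(D : ℤ)) (fun _ => (D : ℤ))) with hW
  have hWf : W.Finite := ((Set.finite_Icc _ _).prod (Set.finite_Icc _ _)).image _
  have hVf : (W ∩ rotSet F).Finite := hWf.inter_of_left _
  refine ⟨hVf.toFinset, ?_, ?_⟩
  · intro v hv
    rw [Set.Finite.mem_toFinset] at hv
    obtain ⟨⟨⟨m, w⟩, -, rfl⟩, -⟩ := hv
    intro i
    refine ⟨(m : ℚ)⁻¹ * w i, ?_⟩
    simp [latt]
  rw [Set.Finite.coe_toFinset]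
  apply Subset.antisymm
  · intro x hx
    by_contra hxV
    obtain ⟨l, α, h1, h2⟩ := geometric_hahn_banach_closed_point (convex_convexHull ℝ (W ∩ rotSet F))
      (Set.Finite.isCompact_convexHull (𝕜 := ℝ) hVf).isClosed hxV
    have hcyc : ∀ m, 1 ≤ m → m ≤ N ^ 2 → ∀ (k : ℕ → Fin 2 → ℤ) (w : Fin 2 → ℤ),
        k m = k 0 + (N : ℤ) • w →
        (∀ a b, a < b → b < m → ∀ u : Fin 2 → ℤ, k b ≠ k a + (N : ℤ) • u) → IsWalk F N m k →
        l (latt w) ≤ α * m := by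
      intro m hm hmN k w hkm hinj hwalk
      have hmem := cycle_mem F hF δ hst N hN hδN m hm k w hkm hinj hwalk
      have hdisp := walk_disp hN hB m k hwalk
      rw [hkm, ctr_add N hN, add_sub_cancel_left] at hdisp
      have hmN' : (m : ℝ) ≤ (N ^ 2 : ℕ) := by exact_mod_cast hmN
      have hwD : ‖latt w‖ < D := by
        refine lt_of_le_of_lt (hdisp.trans ?_) hD
        gcongr
      have hwi : ∀ i, |w i| ≤ (D : ℤ) := by
        intro i
        have := (PiLp.norm_apply_le (latt w) i).trans hwD.le
        have e : ‖(latt w) i‖ = ((|w i| : ℤ) : ℝ) := by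
          simp [latt]
        rw [e] at this
        exact_mod_cast this
      have hWm : (m : ℝ)⁻¹ • latt w ∈ W :=
        ⟨(m, w), ⟨⟨hm, hmN⟩, fun i => (abs_le.1 (hwi i)).1, fun i => (abs_le.1 (hwi i)).2⟩, rfl⟩
      have h3 := h1 _ (subset_convexHull ℝ _ ⟨hWm, hmem⟩)
      rw [map_smul, smul_eq_mul] at h3
      have hm0 : (0 : ℝ) < m := by exact_mod_cast hm
      rw [inv_mul_lt_iff₀ hm0] at h3
      linarith
    have h4 := functional_bound F l α _ (orbit_bound F hN l α _
      (fun n k hk => walk_bound hF hN hB l α hcyc n k hk)) x hx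
    linarith
  · exact convexHull_min inter_subset_right (rotSet_convex F hF)

lemma rotSet_translate (F G : R2 ≃ₜ R2) (hF : Eqv F) (w : R2) (hw : w ∈ intLattice)
    (h : ∀ x, G x = F x + w) (v : R2) (hv : v ∈ rotSet F) : v + w ∈ rotSet G := by
  have key : ∀ (n : ℕ) z, G^[n] z = F^[n] z + (n : ℝ) • w := by
    intro n z
    induction n with
    | zero => simp
    | succ n ih =>
      have hn : (n : ℝ) • w ∈ intLattice := by
        rw [Nat.cast_smul_eq_nsmul]; exact intLattice.nsmul_mem hw n
      rw [Function.iterate_succ_apply', ih, h, hF _ _ hn, Function.iterate_succ_apply']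
      push_cast
      rw [add_smul, one_smul]; abel
  obtain ⟨z, n, hn, ht⟩ := hv
  refine ⟨z, n, hn, ?_⟩
  refine (ht.add_const w).congr' ?_
  filter_upwards [hn.eventually_ge_atTop 1] with j hj
  have : ((n j : ℕ) : ℝ) ≠ 0 := by positivity
  rw [key, add_sub_right_comm, smul_add, smul_smul, inv_mul_cancel₀ this, one_smul]

lemma lifts_differ (f : T2 ≃ₜ T2) (F G : R2 ≃ₜ R2) (hF : IsLift f F) (hG : IsLift f G) :
    ∃ w ∈ intLattice, ∀ x, G x = F x + w := by
  have hmem : ∀ x, G x - F x ∈ intLattice := by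
    intro x
    have : pr (F x) = pr (G x) := by rw [hF.proj, hG.proj]
    have := QuotientAddGroup.eq.1 this
    rwa [neg_add_eq_sub] at this
  refine ⟨G 0 - F 0, hmem 0, fun x => ?_⟩
  have hconst : ∀ i, (G x - F x) i = (G 0 - F 0) i := by
    intro i
    choose c hc using fun y => hmem y i
    have hcc : Continuous fun y => (c y : ℝ) := by
      have : Continuous fun y => (G y - F y) i :=
        (EuclideanSpace.proj i : R2 →L[ℝ] ℝ).continuous.comp (G.continuous.sub F.continuous)
      simpa only [hc] using this
    have hcz : Continuous c := Int.isClosedEmbedding_coe_real.isEmbedding.continuous_iff.2 hcc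
    have : c x = c 0 := PreconnectedSpace.constant inferInstance hcz
    rw [hc, hc, this]
  have : G x - F x = G 0 - F 0 := by ext i; exact hconst i
  rw [← this]; abel

/-- If `f ∈ Homeo₀(T²)` has a stable rotation set, then for any lift `F`
of `f`, the rotation set `ρ(F)` is the convex hull of a finite subset of `ℚ²`. -/
theorem rotSet_polygon_of_stable (f : T2 ≃ₜ T2) (hf : f ∈ Homeo0)
    (hstable : HasStableRotSet Homeo0 f) :
    ∀ F : R2 ≃ₜ R2, IsLift f F →
      ∃ V : Finset R2, (∀ v ∈ V, IsRationalPoint v) ∧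
        rotSet F = convexHull ℝ (V : Set R2) := by
  classical
  intro F hF
  obtain ⟨F₀, hF₀, δ, hδ, hst⟩ := hstable
  obtain ⟨V, hV, hVe⟩ := polygon_of_stable F₀ hF₀.equivariant δ hδ hst
  obtain ⟨w, hw, hwx⟩ := lifts_differ f F₀ F hF₀ hF
  refine ⟨V.image (w + ·), ?_, ?_⟩
  · intro v hv
    obtain ⟨u, hu, rfl⟩ := Finset.mem_image.1 hv
    intro i
    obtain ⟨q, hq⟩ := hV u hu i
    obtain ⟨n, hn⟩ := hw i
    refine ⟨n + q, ?_⟩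
    simp [hq, hn]
  · have e : ((V.image (w + ·) : Finset R2) : Set R2) = w +ᵥ (V : Set R2) := by
      rw [Finset.coe_image]; rfl
    rw [e, convexHull_vadd, ← hVe]
    ext v
    rw [Set.mem_vadd_set_iff_neg_vadd_mem]
    constructor
    · intro hv
      have := rotSet_translate F F₀ hF.equivariant (-w) (neg_mem hw)
        (fun x => by rw [hwx]; abel) v hv
      rwa [vadd_eq_add, add_comm]
    · intro hv
      have := rotSet_translate F₀ F hF₀.equivariant w hw hwx _ hv
      rw [vadd_eq_add] at this
      convert this using 1
      abel
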